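/- Let M be an infinite set and N be any set. If there is a finite-to-one function from N to M, then there is no surjection from N onto the set 𝒫_inf(M) of all infinite subsets of M. -/

import Mathlib

/-- If every fibre of `f : N → M` is countable and `M` is infinite, then `N` injects into `M`. -/
theorem exists_injective_of_countable_fibers {M N : Type*} [Infinite M]
    (f : N → M) (hf : ∀ x : M, (f ⁻¹' {x}).Countable) :
    ∃ i : N → M, Function.Injective i := by
  obtain ⟨e⟩ : Nonempty (M × M ≃ M) :=
    Cardinal.eq.mp (by simp)
  choose c hc using fun x => Set.countable_iff_exists_injOn.mp (hf x)
  refine ⟨fun n => e (f n, Infinite.natEmbedding M (c (f n) n)), fun m n h => ?_⟩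
  obtain ⟨h₁, h₂⟩ := Prod.mk.inj (e.injective h)
  have h₃ := (Infinite.natEmbedding M).injective h₂
  rw [h₁] at h₃
  exact hc (f n) h₁ rfl h₃

/-- The power set of an infinite type injects into the set of its infinite subsets. -/
theorem exists_injective_set_to_infinite_subsets (M : Type*) [Infinite M] :
    ∃ s : Set M → {A : Set M // A.Infinite}, Function.Injective s := by
  obtain ⟨e⟩ : Nonempty (M ⊕ M ≃ M) :=
    Cardinal.eq.mp (by simp)
  refine ⟨fun A => ⟨e '' (Sum.inl '' A ∪ Set.range Sum.inr), ?_⟩, fun A B h => ?_⟩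
  · exact ((Set.infinite_range_of_injective Sum.inr_injective).mono
      Set.subset_union_right).image e.injective.injOn
  · have h' := e.injective.image_injective (congrArg Subtype.val h)
    ext x
    simpa using Set.ext_iff.mp h' (Sum.inl x)

/-- If `M` is infinite and there is a finite-to-one function from `N` to `M`,
then there is no surjection from `N` onto the set of all infinite subsets of `M`. -/
theorem no_surjection_onto_infinite_subsets_of_finiteToOne (M N : Type*) [Infinite M]
    (f : N → M) (hf : ∀ x : M, (f ⁻¹' {x}).Finite) :
    ¬ ∃ g : N → {A : Set M // A.Infinite}, Function.Surjective g := by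
  rintro ⟨g, hg⟩
  obtain ⟨i, hi⟩ := exists_injective_of_countable_fibers f fun x => (hf x).countable
  obtain ⟨s, hs⟩ := exists_injective_set_to_infinite_subsets M
  exact Function.cantor_injective _ (hi.comp ((Function.injective_surjInv hg).comp hs))
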